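/- Let (G, X, H) be an A/QI triple. Then H has finite height in G: there is an N such that for any collection of distinct cosets g₁H, …, g_kH with ⋂_{i=1}^k g_i H g_i⁻¹ infinite, we have k ≤ N. Explicitly, N may be taken to be the acylindricity constant N(Q, Hx₀) associated to a quasi-convexity constant Q of 2δ-quasi-geodesics with endpoints in Hx₀ ∪ Λ(Hx₀). -/

import Mathlib

open Metric Set

/-- The Gromov product `(x∣y)_w`. -/
noncomputable def gprod {X : Type*} [MetricSpace X] (w x y : X) : ℝ :=
  (dist w x + dist w y - dist x y) / 2

/-- A geodesic metric space. -/
def IsGeodesicSpace (X : Type*) [MetricSpace X] : Prop :=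
  ∀ x y : X, ∃ γ : ℝ → X, γ 0 = x ∧ γ (dist x y) = y ∧
    ∀ s ∈ Set.Icc (0:ℝ) (dist x y), ∀ t ∈ Set.Icc (0:ℝ) (dist x y),
      dist (γ s) (γ t) = |s - t|

/-- Word length with respect to a (symmetrized) generating set `S`. -/
noncomputable def wlen {G : Type*} [Group G] (S : Set G) (g : G) : ℕ :=
  sInf {n | ∃ l : List G, l.length = n ∧ (∀ x ∈ l, x ∈ S ∨ x⁻¹ ∈ S) ∧ l.prod = g}

/-- Chaining the hyperbolicity inequality along a sequence of at most `2 ^ k` steps. -/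
theorem sub_mul_le_gprod_of_chain {X : Type*} [MetricSpace X] {δ : ℝ}
    (hhyp : ∀ w x y z : X, min (gprod w x y) (gprod w y z) - δ ≤ gprod w x z)
    (z : X) (p : ℕ → X) {n : ℕ} {c : ℝ} (hz : ∀ i ≤ n, c ≤ dist z (p i))
    (hstep : ∀ i < n, c ≤ gprod z (p i) (p (i + 1))) (k : ℕ) :
    ∀ i j : ℕ, i ≤ j → j ≤ n → j - i ≤ 2 ^ k → c - k * δ ≤ gprod z (p i) (p j) := by
  have self : ∀ i ≤ n, c ≤ gprod z (p i) (p i) := by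
    intro i hi
    have := hz i hi
    simp only [gprod, dist_self]
    linarith
  induction k with
  | zero =>
    intro i j hij hj hk
    simp only [Nat.cast_zero, zero_mul, sub_zero]
    rcases hij.eq_or_lt with rfl | hlt
    · exact self i hj
    · obtain rfl : j = i + 1 := by omega
      exact hstep i (by omega)
  | succ k ih =>
    intro i j hij hj hk
    rw [pow_succ] at hk
    have h := hhyp z (p i) (p (min j (i + 2 ^ k))) (p j)
    have h1 := ih i (min j (i + 2 ^ k)) (by omega) (by omega) (by omega)
    have h2 := ih (min j (i + 2 ^ k)) j (by omega) hj (by omega)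
    have := le_min h1 h2
    push_cast
    linarith

theorem gprod_swap {X : Type*} [MetricSpace X] (w x y : X) : gprod w x y = gprod w y x := by
  simp only [gprod, dist_comm x y]
  ring

/-- A real number bounded by logarithmically many multiples of `δ` is bounded. -/
theorem exists_bound_of_le_log {δ : ℝ} (hδ : 0 < δ) (a A B : ℝ) :
    ∃ Q : ℝ, ∀ R : ℝ, (∀ k : ℕ, A * R + B ≤ 2 ^ k → R ≤ a + k * δ) → R ≤ Q := by
  have hlim : Filter.Tendsto
      (fun k : ℕ => |A| * δ * ((k : ℝ) ^ 1 / 2 ^ k) + (|A| * (|a| + δ) + |B|) * (1 / 2 : ℝ) ^ k)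
      Filter.atTop (nhds (|A| * δ * 0 + (|A| * (|a| + δ) + |B|) * 0)) :=
    ((tendsto_pow_const_div_const_pow_of_one_lt 1 (by norm_num)).const_mul _).add
      ((tendsto_pow_atTop_nhds_zero_of_lt_one (by norm_num) (by norm_num)).const_mul _)
  have hev := hlim.eventually_le_const (u := 1) (by norm_num)
  obtain ⟨K, hK⟩ := Filter.eventually_atTop.1 hev
  refine ⟨max 0 (a + K * δ), fun R hR => ?_⟩
  by_contra! hlt
  obtain ⟨hR0, hRK⟩ := max_lt_iff.1 hlt
  set m := ⌈(R - a) / δ⌉₊ with hm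
  have hKm : K < m := by
    rw [hm, Nat.lt_ceil, lt_div_iff₀ hδ]
    linarith
  obtain ⟨k, hk⟩ : ∃ k, m = k + 1 := ⟨m - 1, by omega⟩
  have hlow : a + k * δ < R := by
    have : k < m := by omega
    rw [hm, Nat.lt_ceil, lt_div_iff₀ hδ] at this
    linarith
  have hup : R ≤ a + (k + 1) * δ := by
    have : (R - a) / δ ≤ (m : ℝ) := Nat.le_ceil _
    rw [div_le_iff₀ hδ, hk] at this
    push_cast at this
    linarith
  refine absurd (hR k ?_) (not_le.2 hlow)
  have h := hK k (by omega)
  have hpos : (0 : ℝ) < 2 ^ k := by positivity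
  have h' : |A| * δ * k + (|A| * (|a| + δ) + |B|) ≤ 2 ^ k := by
    have := mul_le_mul_of_nonneg_right h hpos.le
    rw [one_mul] at this
    refine le_trans (le_of_eq ?_) this
    rw [one_div, inv_pow]
    field_simp
  have h1 : A * R ≤ |A| * R := mul_le_mul_of_nonneg_right (le_abs_self A) hR0.le
  have h2 : |A| * R ≤ |A| * (|a| + (k + 1) * δ) :=
    mul_le_mul_of_nonneg_left (hup.trans (by linarith [le_abs_self a])) (abs_nonneg A)
  linarith [le_abs_self B]

/-- Stability of quasi-geodesics: in a hyperbolic space a geodesic joining the endpoints of a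
discrete quasi-geodesic stays uniformly close to it. -/
theorem exists_geodesic_near_quasigeodesic {X : Type*} [MetricSpace X] {δ : ℝ} (hδ : 0 < δ)
    (hhyp : ∀ w x y z : X, min (gprod w x y) (gprod w y z) - δ ≤ gprod w x z)
    {K A B : ℝ} (hK : 0 ≤ K) (hA : 0 ≤ A) :
    ∃ Q : ℝ, 0 ≤ Q ∧ ∀ (p : ℕ → X) (n : ℕ) (γ : ℝ → X) (L : ℝ), 0 ≤ L → γ 0 = p 0 → γ L = p n →
      (∀ s ∈ Set.Icc (0 : ℝ) L, ∀ t ∈ Set.Icc (0 : ℝ) L, dist (γ s) (γ t) = |s - t|) →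
      (∀ i < n, dist (p i) (p (i + 1)) ≤ K) →
      (∀ i j, i ≤ j → j ≤ n → (j - i : ℝ) ≤ A * dist (p i) (p j) + B) →
      ∀ t ∈ Set.Icc (0 : ℝ) L, ∃ i ≤ n, dist (γ t) (p i) ≤ Q := by
  obtain ⟨Q, hQ⟩ := exists_bound_of_le_log hδ (K / 2 + 2 * δ) (6 * A) B
  refine ⟨max Q 0, le_max_right _ _, fun p n γ L hL h0 hn hγ hstep hqi => ?_⟩
  set P : Set X := p '' Set.Iic n with hP
  have hPc : IsCompact P := ((Set.finite_Iic n).image p).isCompact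
  have hPne : P.Nonempty := ⟨p 0, 0, by simp, rfl⟩
  have hcont : ContinuousOn (fun t => infDist (γ t) P) (Set.Icc 0 L) := by
    refine (continuous_infDist_pt P).comp_continuousOn ?_
    refine (LipschitzOnWith.of_dist_le_mul (K := 1) fun s hs t ht => ?_).continuousOn
    simp [hγ s hs t ht, Real.dist_eq]
  obtain ⟨t₀, ht₀, hmax⟩ := isCompact_Icc.exists_isMaxOn (Set.nonempty_Icc.2 hL) hcont
  set R := infDist (γ t₀) P with hR
  have hR0 : 0 ≤ R := infDist_nonneg
  have hnear : ∀ t ∈ Set.Icc (0 : ℝ) L, ∃ i ≤ n, dist (γ t) (p i) ≤ R := by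
    intro t ht
    obtain ⟨_, ⟨i, hi, rfl⟩, hd⟩ := hPc.exists_infDist_eq_dist hPne (γ t)
    exact ⟨i, hi, hd ▸ hmax ht⟩
  have hfar : ∀ i ≤ n, R ≤ dist (γ t₀) (p i) := fun i hi =>
    infDist_le_dist_of_mem ⟨i, hi, rfl⟩
  have side : ∀ s ∈ Set.Icc (0 : ℝ) L, ∀ i ≤ n, dist (γ s) (p i) ≤ R → |t₀ - s| = 2 * R →
      R ≤ gprod (γ t₀) (γ s) (p i) := by
    intro s hs i hi hd hs2
    have h1 := hγ t₀ ht₀ s hs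
    have h2 := hfar i hi
    simp only [gprod]
    linarith
  have endpt : ∀ i ≤ n, R ≤ gprod (γ t₀) (p i) (p i) := by
    intro i hi
    have := hfar i hi
    simp only [gprod, dist_self]
    linarith
  have left : ∃ s ∈ Set.Icc (0 : ℝ) L, s ≤ t₀ ∧ t₀ - s ≤ 2 * R ∧
      ∃ i ≤ n, dist (γ s) (p i) ≤ R ∧ R ≤ gprod (γ t₀) (γ s) (p i) := by
    by_cases h : 2 * R ≤ t₀
    · have hs : t₀ - 2 * R ∈ Set.Icc (0 : ℝ) L := ⟨by linarith, by linarith [ht₀.2]⟩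
      obtain ⟨i, hi, hd⟩ := hnear _ hs
      refine ⟨_, hs, by linarith, by linarith, i, hi, hd, side _ hs i hi hd ?_⟩
      rw [sub_sub_cancel, abs_of_nonneg (by linarith)]
    · refine ⟨0, ⟨le_rfl, hL⟩, ht₀.1, by linarith, 0, by simp, ?_, ?_⟩
      · simpa [h0] using hR0
      · rw [h0]
        exact endpt 0 (by simp)
  have right : ∃ s ∈ Set.Icc (0 : ℝ) L, t₀ ≤ s ∧ s - t₀ ≤ 2 * R ∧
      ∃ i ≤ n, dist (γ s) (p i) ≤ R ∧ R ≤ gprod (γ t₀) (γ s) (p i) := by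
    by_cases h : t₀ + 2 * R ≤ L
    · have hs : t₀ + 2 * R ∈ Set.Icc (0 : ℝ) L := ⟨by linarith [ht₀.1], h⟩
      obtain ⟨i, hi, hd⟩ := hnear _ hs
      refine ⟨_, hs, by linarith, by linarith, i, hi, hd, side _ hs i hi hd ?_⟩
      rw [sub_add_cancel_left, abs_neg, abs_of_nonneg (by linarith)]
    · refine ⟨L, ⟨hL, le_rfl⟩, ht₀.2, by linarith, n, le_rfl, ?_, ?_⟩
      · simpa [hn] using hR0
      · rw [hn]
        exact endpt n le_rfl
  obtain ⟨s, hs, hst, hs2, i, hi, hdi, hgi⟩ := left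
  obtain ⟨u, hu, hut, hu2, j, hj, hdj, hgj⟩ := right
  have hzero : gprod (γ t₀) (γ s) (γ u) = 0 := by
    simp only [gprod]
    rw [hγ t₀ ht₀ s hs, hγ t₀ ht₀ u hu, hγ s hs u hu, abs_of_nonneg (by linarith),
      abs_of_nonpos (by linarith), abs_of_nonpos (by linarith)]
    ring
  have hpij : dist (p i) (p j) ≤ 6 * R := by
    have h1 := dist_triangle4 (p i) (γ s) (γ u) (p j)
    rw [hγ s hs u hu, abs_of_nonpos (by linarith), dist_comm (p i) (γ s)] at h1
    linarith
  have hbound : R ≤ Q := by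
    refine hQ R fun k hk => ?_
    have hchain : R - K / 2 - k * δ ≤ gprod (γ t₀) (p i) (p j) := by
      have key := sub_mul_le_gprod_of_chain hhyp (γ t₀) p (n := n) (c := R - K / 2)
        (fun i hi => by linarith [hfar i hi])
        (fun i hi => by
          have h1 := hfar i hi.le
          have h2 := hfar (i + 1) hi
          have h3 := hstep i hi
          simp only [gprod]
          linarith) k
      have hAd : A * dist (p i) (p j) ≤ A * (6 * R) := mul_le_mul_of_nonneg_left hpij hA
      rcases le_total i j with hij | hij
      · refine key i j hij hj ?_
        have := hqi i j hij hj
        have h4 : ((j - i : ℕ) : ℝ) ≤ ((2 ^ k : ℕ) : ℝ) := by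
          push_cast [hij]
          linarith
        exact_mod_cast h4
      · rw [gprod_swap]
        refine key j i hij hi ?_
        have := hqi j i hij hi
        rw [dist_comm] at this
        have h4 : ((i - j : ℕ) : ℝ) ≤ ((2 ^ k : ℕ) : ℝ) := by
          push_cast [hij]
          linarith
        exact_mod_cast h4
    have hkδ : 0 ≤ k * δ := by positivity
    have h1 := hhyp (γ t₀) (γ s) (p i) (γ u)
    have h2 := hhyp (γ t₀) (p i) (p j) (γ u)
    rw [gprod_swap] at hgj
    have h3 := le_min hchain (show R - K / 2 - k * δ ≤ gprod (γ t₀) (p j) (γ u) by linarith)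
    have h4 := le_min (show R - K / 2 - k * δ - δ ≤ gprod (γ t₀) (γ s) (p i) by linarith)
      (show R - K / 2 - k * δ - δ ≤ gprod (γ t₀) (p i) (γ u) by linarith)
    linarith
  intro t ht
  obtain ⟨i, hi, hd⟩ := hnear t ht
  exact ⟨i, hi, hd.trans (hbound.trans (le_max_left _ _))⟩

/-- The distance from a point to a geodesic is at most the Gromov product of its endpoints, up to
an error of `2 * δ`. -/
theorem exists_dist_geodesic_le {X : Type*} [MetricSpace X] {δ : ℝ}
    (hhyp : ∀ w x y z : X, min (gprod w x y) (gprod w y z) - δ ≤ gprod w x z)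
    {a b : X} {γ : ℝ → X} (h0 : γ 0 = a) (h1 : γ (dist a b) = b)
    (hγ : ∀ s ∈ Set.Icc (0 : ℝ) (dist a b), ∀ t ∈ Set.Icc (0 : ℝ) (dist a b),
      dist (γ s) (γ t) = |s - t|) (z : X) :
    ∃ t ∈ Set.Icc (0 : ℝ) (dist a b), dist z (γ t) ≤ gprod z a b + 2 * δ := by
  have hL : 0 ≤ dist a b := dist_nonneg
  have ht : gprod a z b ∈ Set.Icc (0 : ℝ) (dist a b) := by
    have e1 := dist_triangle z a b
    have e2 := dist_triangle a b z
    have e3 := dist_triangle a z b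
    simp only [gprod, Set.mem_Icc]
    rw [dist_comm a z, dist_comm b z] at *
    constructor <;> linarith
  refine ⟨_, ht, ?_⟩
  set t := gprod a z b with htdef
  have da : dist (γ t) a = t := by
    have := hγ t ht 0 ⟨le_rfl, hL⟩
    rwa [h0, sub_zero, abs_of_nonneg ht.1] at this
  have db : dist (γ t) b = dist a b - t := by
    have := hγ t ht (dist a b) ⟨hL, le_rfl⟩
    rwa [h1, abs_of_nonpos (by linarith [ht.2]), neg_sub] at this
  have h := hhyp (γ t) a z b
  have m : (dist z (γ t) - gprod z a b) / 2 ≤ min (gprod (γ t) a z) (gprod (γ t) z b) := by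
    apply le_min <;>
    · simp only [gprod] at htdef ⊢
      linarith [dist_comm (γ t) z, dist_comm a z]
  have e : gprod (γ t) a b = 0 := by
    simp only [gprod, da, db]
    ring
  linarith

theorem wlen_prod_le {G : Type*} [Group G] {S : Set G} {l : List G}
    (hl : ∀ x ∈ l, x ∈ S ∨ x⁻¹ ∈ S) : wlen S l.prod ≤ l.length :=
  Nat.sInf_le ⟨l, rfl, hl, rfl⟩

theorem exists_list_length_eq_wlen {G : Type*} [Group G] {S : Set G} {g : G}
    (hg : g ∈ Subgroup.closure S) :
    ∃ l : List G, l.length = wlen S g ∧ (∀ x ∈ l, x ∈ S ∨ x⁻¹ ∈ S) ∧ l.prod = g := by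
  refine Nat.sInf_mem
    (s := {n | ∃ l : List G, l.length = n ∧ (∀ x ∈ l, x ∈ S ∨ x⁻¹ ∈ S) ∧ l.prod = g}) ?_
  rw [← Subgroup.mem_toSubmonoid, Subgroup.closure_toSubmonoid] at hg
  obtain ⟨l, hl, hprod⟩ := Submonoid.exists_list_of_mem_closure hg
  exact ⟨l.length, l, rfl, fun x hx => by simpa using hl x hx, hprod⟩

theorem wlen_mul_le {G : Type*} [Group G] {S : Set G} {a b : G}
    (ha : a ∈ Subgroup.closure S) (hb : b ∈ Subgroup.closure S) :
    wlen S (a * b) ≤ wlen S a + wlen S b := by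
  obtain ⟨l, hl, hlS, rfl⟩ := exists_list_length_eq_wlen ha
  obtain ⟨m, hm, hmS, rfl⟩ := exists_list_length_eq_wlen hb
  rw [← hl, ← hm, ← List.prod_append, ← List.length_append]
  refine wlen_prod_le fun x hx => ?_
  rcases List.mem_append.1 hx with h | h
  exacts [hlS x h, hmS x h]

theorem finite_setOf_wlen_le {G : Type*} [Group G] {S : Set G} (hS : S.Finite) (n : ℕ) :
    {g | g ∈ Subgroup.closure S ∧ wlen S g ≤ n}.Finite := by
  have hS' : (S ∪ S⁻¹).Finite := hS.union hS.inv
  have : Finite ↥(S ∪ S⁻¹) := hS'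
  refine ((List.finite_length_le ↥(S ∪ S⁻¹) n).image
    fun l => (l.map Subtype.val).prod).subset ?_
  rintro g ⟨hg, hn⟩
  obtain ⟨l, hl, hlS, rfl⟩ := exists_list_length_eq_wlen hg
  lift l to List ↥(S ∪ S⁻¹) using fun x hx => by simpa using hlS x hx
  refine ⟨l, ?_, rfl⟩
  rw [List.length_map] at hl
  simpa [hl] using hn

/-- A quasi-isometrically embedded subgroup of a group acting on a hyperbolic space has
quasi-convex orbits, with a constant that is uniform over its cosets. -/
theorem exists_quasiconvex_orbit {G X : Type*} [Group G] [MetricSpace X] [MulAction G X]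
    (hiso : ∀ (g : G) (x y : X), dist (g • x) (g • y) = dist x y) {δ : ℝ} (hδ : 0 < δ)
    (hhyp : ∀ w x y z : X, min (gprod w x y) (gprod w y z) - δ ≤ gprod w x z)
    (x₀ : X) (H : Subgroup G) (S : Set G) (hSgen : Subgroup.closure S = H)
    {C : ℝ} (hC : 1 ≤ C)
    (hqie : ∀ h ∈ H, (wlen S h : ℝ) / C - C ≤ dist (h • x₀) x₀ ∧
      dist (h • x₀) x₀ ≤ C * (wlen S h) + C) :
    ∃ Q : ℝ, 0 ≤ Q ∧ ∀ g : G, ∀ h ∈ H, ∀ γ : ℝ → X, ∀ L : ℝ, 0 ≤ L →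
      γ 0 = g • x₀ → γ L = (g * h) • x₀ →
      (∀ s ∈ Set.Icc (0 : ℝ) L, ∀ t ∈ Set.Icc (0 : ℝ) L, dist (γ s) (γ t) = |s - t|) →
      ∀ t ∈ Set.Icc (0 : ℝ) L, ∃ h' ∈ H, dist (γ t) ((g * h') • x₀) ≤ Q := by
  have hC0 : 0 < C := by linarith
  obtain ⟨Q, hQ0, hQ⟩ := exists_geodesic_near_quasigeodesic (A := C) (B := C * C) (K := 2 * C)
    hδ hhyp (by linarith) hC0.le
  refine ⟨Q, hQ0, fun g h hh γ L hL h0 hn hγ t ht => ?_⟩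
  obtain ⟨l, hl, hlS, rfl⟩ := exists_list_length_eq_wlen (hSgen ▸ hh)
  have memS : ∀ m : List G, (∀ x ∈ m, x ∈ S ∨ x⁻¹ ∈ S) → m.prod ∈ H := by
    intro m hm
    refine Subgroup.list_prod_mem _ fun x hx => ?_
    rw [← hSgen]
    rcases hm x hx with h | h
    · exact Subgroup.subset_closure h
    · exact (Subgroup.inv_mem_iff _).1 (Subgroup.subset_closure h)
  have takeS : ∀ i, ∀ x ∈ l.take i, x ∈ S ∨ x⁻¹ ∈ S := fun i x hx => hlS x (List.mem_of_mem_take hx)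
  have dropS : ∀ i, ∀ x ∈ l.drop i, x ∈ S ∨ x⁻¹ ∈ S := fun i x hx => hlS x (List.mem_of_mem_drop hx)
  set q : ℕ → G := fun i => (l.take i).prod with hq
  have hqH : ∀ i, q i ∈ H := fun i => memS _ (takeS i)
  have hdist : ∀ i j, dist ((g * q i) • x₀) ((g * q j) • x₀) = dist (((q i)⁻¹ * q j) • x₀) x₀ := by
    intro i j
    rw [mul_smul, mul_smul, hiso, ← hiso (q i)⁻¹, inv_smul_smul, ← mul_smul, dist_comm]
  have hstep : ∀ i < l.length,
      dist ((g * q i) • x₀) ((g * q (i + 1)) • x₀) ≤ 2 * C := by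
    intro i hi
    have e : (q i)⁻¹ * q (i + 1) = [l[i]].prod := by
      rw [inv_mul_eq_iff_eq_mul, List.prod_singleton]
      exact List.prod_take_succ l i hi
    have hm : ∀ x ∈ [l[i]], x ∈ S ∨ x⁻¹ ∈ S := by
      simpa using hlS _ (List.getElem_mem hi)
    have h1 : wlen S [l[i]].prod ≤ 1 := wlen_prod_le hm
    have h1' : (wlen S [l[i]].prod : ℝ) ≤ 1 := by exact_mod_cast h1
    rw [hdist, e]
    have h2 := (hqie _ (memS _ hm)).2
    nlinarith
  have hqi : ∀ i j, i ≤ j → j ≤ l.length →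
      (j - i : ℝ) ≤ C * dist ((g * q i) • x₀) ((g * q j) • x₀) + C * C := by
    intro i j hij hj
    have hmem : (q i)⁻¹ * q j ∈ H := H.mul_mem (H.inv_mem (hqH i)) (hqH j)
    have hw : j - i ≤ wlen S ((q i)⁻¹ * q j) := by
      have e : l.prod = q i * ((q i)⁻¹ * q j) * (l.drop j).prod := by
        simp [hq, List.prod_take_mul_prod_drop]
      have h1 : wlen S (q i) ≤ i := (wlen_prod_le (takeS i)).trans (by simp)
      have h2 : wlen S (l.drop j).prod ≤ l.length - j := (wlen_prod_le (dropS j)).trans (by simp)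
      have h3 := wlen_mul_le (S := S) (a := q i * ((q i)⁻¹ * q j)) (b := (l.drop j).prod)
        (by rw [hSgen]; exact H.mul_mem (hqH i) hmem) (by rw [hSgen]; exact memS _ (dropS j))
      have h4 := wlen_mul_le (S := S) (a := q i) (b := (q i)⁻¹ * q j)
        (by rw [hSgen]; exact hqH i) (by rw [hSgen]; exact hmem)
      rw [← e] at h3
      omega
    have hw' : (j - i : ℝ) ≤ wlen S ((q i)⁻¹ * q j) := by
      have : (j : ℝ) ≤ wlen S ((q i)⁻¹ * q j) + i := by exact_mod_cast Nat.sub_le_iff_le_add.1 hw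
      linarith
    have h5 := (hqie _ hmem).1
    rw [tsub_le_iff_right, div_le_iff₀ hC0] at h5
    rw [hdist]
    linarith
  obtain ⟨i, -, hi⟩ := hQ (fun i => (g * q i) • x₀) l.length γ L hL (by simpa [hq] using h0)
    (by simpa [hq] using hn) hγ hstep hqi t ht
  exact ⟨q i, hqH i, hi⟩

/-- A point `z` with `gprod z a b = 0` far from both `a` and `b` is close to any geodesic whose
endpoints are close to `a` and `b`. -/
theorem exists_dist_nearby_geodesic_le {X : Type*} [MetricSpace X] {δ : ℝ}
    (hhyp : ∀ w x y z : X, min (gprod w x y) (gprod w y z) - δ ≤ gprod w x z)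
    {a b a' b' z : X} {M : ℝ} (hz : gprod z a b = 0) (ha : dist a a' ≤ M) (hb : dist b b' ≤ M)
    (hδ : 0 ≤ δ) (hza : M + 2 * δ < dist z a) (hzb : M + 2 * δ < dist z b)
    {γ : ℝ → X} (h0 : γ 0 = a') (h1 : γ (dist a' b') = b')
    (hγ : ∀ s ∈ Set.Icc (0 : ℝ) (dist a' b'), ∀ t ∈ Set.Icc (0 : ℝ) (dist a' b'),
      dist (γ s) (γ t) = |s - t|) :
    ∃ t ∈ Set.Icc (0 : ℝ) (dist a' b'), dist z (γ t) ≤ 4 * δ := by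
  obtain ⟨t, ht, hd⟩ := exists_dist_geodesic_le hhyp h0 h1 hγ z
  refine ⟨t, ht, hd.trans ?_⟩
  have e1 : 2 * δ < gprod z a a' := by
    have := dist_triangle z a' a
    rw [dist_comm a' a] at this
    simp only [gprod]
    linarith
  have e2 : 2 * δ < gprod z b' b := by
    have := dist_triangle z b' b
    rw [dist_comm b' b] at this
    simp only [gprod]
    rw [dist_comm b' b]
    linarith
  by_contra! hlt
  have h2 := hhyp z a a' b
  have h3 := hhyp z a' b' b
  have h4 := lt_min (show 2 * δ < gprod z a' b' by linarith) e2
  have h5 := lt_min (show δ < gprod z a a' by linarith) (show δ < gprod z a' b by linarith)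
  linarith

/-- Proposition 4.8: if `(G,X,H)` is an A/QI triple then `H` has finite
height in `G`: there is `N` so that any family of distinct cosets `g₁H,…,g_kH` with
`⋂ gᵢHgᵢ⁻¹` infinite has `k ≤ N`. -/
theorem aqi_triple_finite_height
    {G X : Type*} [Group G] [MetricSpace X] [MulAction G X]
    (hiso : ∀ (g : G) (x y : X), dist (g • x) (g • y) = dist x y)
    (δ : ℝ) (hδ : 1 ≤ δ)
    (hhyp : ∀ w x y z : X, min (gprod w x y) (gprod w y z) - δ ≤ gprod w x z)
    (hgeo : IsGeodesicSpace X)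
    (x₀ : X) (H : Subgroup G)
    (hHinf : ((H : Set G)).Infinite)
    -- H is finitely generated and quasi-isometrically embedded by the orbit map
    (S : Set G) (hSfin : S.Finite) (hSgen : Subgroup.closure S = H)
    (C : ℝ) (hC : 1 ≤ C)
    (hqie : ∀ h ∈ H, (wlen S h : ℝ) / C - C ≤ dist (h • x₀) x₀ ∧
      dist (h • x₀) x₀ ≤ C * (wlen S h) + C)
    -- acylindricity along H in the coset-intersection form, with constants D(ε), N(ε)
    (D : ℝ → ℝ) (N : ℝ → ℕ)
    (hacyl : ∀ ε : ℝ, 0 ≤ ε → ∀ T : Finset G,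
      (∀ g ∈ T, ∀ g' ∈ T, g ≠ g' → g⁻¹ * g' ∉ H) →
      (∃ z w : X, (∀ g ∈ T, (∃ h ∈ H, dist z ((g * h) • x₀) ≤ ε) ∧
          (∃ h ∈ H, dist w ((g * h) • x₀) ≤ ε)) ∧ D ε < dist z w) →
      T.card ≤ N ε) :
    ∃ Nh : ℕ, ∀ T : Finset G,
      (∀ g ∈ T, ∀ g' ∈ T, g ≠ g' → g⁻¹ * g' ∉ H) →
      ({x : G | ∀ g ∈ T, g⁻¹ * x * g ∈ H}).Infinite →
      T.card ≤ Nh := by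
  have hδ0 : 0 < δ := by linarith
  obtain ⟨Q, hQ0, hQ⟩ := exists_quasiconvex_orbit hiso hδ0 hhyp x₀ H S hSgen hC hqie
  refine ⟨N (Q + 4 * δ), fun T hT hinf => ?_⟩
  rcases T.eq_empty_or_nonempty with rfl | ⟨g₀, hg₀⟩
  · simp
  refine hacyl _ (by linarith) T hT ?_
  obtain ⟨M, hM⟩ := (T.finite_toSet.image fun g => dist (g₀ • x₀) (g • x₀)).bddAbove
  replace hM : ∀ g ∈ T, dist (g₀ • x₀) (g • x₀) ≤ M := fun g hg => hM ⟨g, hg, rfl⟩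
  have hM0 : 0 ≤ M := dist_nonneg.trans (hM g₀ hg₀)
  set r := M + 2 * δ + 1 with hr
  have hr0 : 0 < r := by positivity
  obtain ⟨x, hx, hxL⟩ : ∃ x : G, (∀ g ∈ T, g⁻¹ * x * g ∈ H) ∧
      2 * r + |D (Q + 4 * δ)| < dist (g₀ • x₀) (x • g₀ • x₀) := by
    have hfin := finite_setOf_wlen_le hSfin ⌈C * (2 * r + |D (Q + 4 * δ)| + C)⌉₊
    have hinj : Function.Injective fun x : G => g₀⁻¹ * x * g₀ := fun x y hxy => by simpa using hxy
    obtain ⟨x, hx, hxn⟩ := (hinf.sdiff (hfin.preimage hinj.injOn)).nonempty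
    refine ⟨x, hx, ?_⟩
    have hmem := hx g₀ hg₀
    have hlt : ⌈C * (2 * r + |D (Q + 4 * δ)| + C)⌉₊ < wlen S (g₀⁻¹ * x * g₀) := by
      by_contra! h
      exact hxn ⟨hSgen ▸ hmem, h⟩
    have hC0 : 0 < C := by linarith
    have h1 := (Nat.ceil_le.1 (le_refl _)).trans_lt (Nat.cast_lt (α := ℝ).2 hlt)
    have h2 := (hqie _ hmem).1
    rw [mul_comm, ← lt_div_iff₀ hC0] at h1
    have h3 : dist (g₀ • x₀) (x • g₀ • x₀) = dist ((g₀⁻¹ * x * g₀) • x₀) x₀ := by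
      rw [mul_smul, mul_smul, ← hiso g₀ _ x₀, smul_inv_smul, dist_comm]
    linarith
  set L := dist (g₀ • x₀) (x • g₀ • x₀) with hL
  have hD := abs_nonneg (D (Q + 4 * δ))
  obtain ⟨γ, hγ0, hγ1, hγ⟩ := hgeo (g₀ • x₀) (x • g₀ • x₀)
  rw [← hL] at hγ1 hγ
  have near : ∀ s, r ≤ s → s ≤ L - r → ∀ g ∈ T, ∃ h ∈ H,
      dist (γ s) ((g * h) • x₀) ≤ Q + 4 * δ := by
    intro s hs hsL g hg
    have hsI : s ∈ Set.Icc (0 : ℝ) L := ⟨by linarith, by linarith⟩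
    have da : dist (γ s) (g₀ • x₀) = s := by
      rw [← hγ0, hγ s hsI 0 ⟨le_rfl, by linarith⟩, sub_zero, abs_of_nonneg hsI.1]
    have db : dist (γ s) (x • g₀ • x₀) = L - s := by
      have := hγ s hsI L ⟨by linarith, le_rfl⟩
      rwa [hγ1, abs_of_nonpos (by linarith [hsI.2]), neg_sub] at this
    obtain ⟨η, hη0, hη1, hη⟩ := hgeo (g • x₀) (x • g • x₀)
    obtain ⟨t, ht, hd⟩ := exists_dist_nearby_geodesic_le (M := M) hhyp (z := γ s)
      (a := g₀ • x₀) (b := x • g₀ • x₀)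
      (by simp only [gprod, da, db, ← hL]; ring) (hM g hg) ((hiso x _ _).trans_le (hM g hg))
      hδ0.le (by linarith) (by linarith) hη0 hη1 hη
    obtain ⟨h, hh, hd'⟩ := hQ g _ (hx g hg) η _ dist_nonneg hη0
      (by rw [hη1, ← mul_smul]; congr 1; group) hη t ht
    exact ⟨h, hh, by linarith [dist_triangle (γ s) (η t) ((g * h) • x₀)]⟩
  refine ⟨γ r, γ (L - r), fun g hg => ⟨near r le_rfl (by linarith) g hg,
    near (L - r) (by linarith) le_rfl g hg⟩, ?_⟩
  rw [hγ r ⟨by linarith, by linarith⟩ (L - r) ⟨by linarith, by linarith⟩,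
    abs_of_nonpos (by linarith)]
  linarith [le_abs_self (D (Q + 4 * δ))]
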